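/- arXiv:2105.04156 — 3 statements merged into one kernel-verified Lean document; each statement's English description precedes it below -/
import Mathlib

section
/- For every integer L ≥ 1, sup_{x ∈ [−1,1]} |x² − ŝ_L(x)| = 2^{−2L}, and the function x ↦ x² − ŝ_L(x) is Lipschitz on [−1,1] with Lipschitz constant at most 2^{−(L−1)}, i.e., |(x² − ŝ_L(x)) − (y² − ŝ_L(y))| ≤ 2^{−(L−1)}|x − y| for all x, y ∈ [−1,1]. -/
/-- The hat function `g`. -/
noncomputable def hatg (x : ℝ) : ℝ :=
  if 0 ≤ x ∧ x ≤ 1/2 then 2*x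
  else if 1/2 < x ∧ x ≤ 1 then 2*(1-x)
  else 0

/-- `ŝ_L(x) = |x| − Σ_{ℓ=1}^{L−1} 2^{−2ℓ} g_ℓ(|x|)`. -/
noncomputable def sHat (L : ℕ) (x : ℝ) : ℝ :=
  |x| - ∑ ℓ ∈ Finset.Icc 1 (L-1), (2:ℝ)^(-(2*(ℓ:ℤ))) * hatg^[ℓ] |x|

theorem hatg_eq_one_sub_abs {t : ℝ} (ht : t ∈ Set.Icc (0:ℝ) 1) : hatg t = 1 - |2*t - 1| := by
  obtain ⟨h0, h1⟩ := ht
  unfold hatg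
  rcases le_or_gt t (1/2) with h | h
  · rw [if_pos ⟨h0, h⟩, abs_of_nonpos (by linarith)]; ring
  · rw [if_neg (fun hc => absurd hc.2 (not_le.mpr h)), if_pos ⟨h, h1⟩,
      abs_of_nonneg (by linarith)]; ring

theorem hatg_mem_Icc {t : ℝ} (ht : t ∈ Set.Icc (0:ℝ) 1) : hatg t ∈ Set.Icc (0:ℝ) 1 := by
  rw [hatg_eq_one_sub_abs ht]
  have h : |2*t - 1| ≤ 1 := abs_le.mpr ⟨by linarith [ht.1], by linarith [ht.2]⟩
  exact ⟨by linarith, by linarith [abs_nonneg (2*t - 1)]⟩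

theorem abs_hatg_sub_hatg_le {s t : ℝ} (hs : s ∈ Set.Icc (0:ℝ) 1) (ht : t ∈ Set.Icc (0:ℝ) 1) :
    |hatg s - hatg t| ≤ 2 * |s - t| := by
  rw [hatg_eq_one_sub_abs hs, hatg_eq_one_sub_abs ht]
  calc |1 - |2*s - 1| - (1 - |2*t - 1|)| = |(|2*t - 1| - |2*s - 1|)| := by ring_nf
    _ ≤ |(2*t - 1) - (2*s - 1)| := abs_abs_sub_abs_le _ _
    _ = |2 * (t - s)| := by ring_nf
    _ = 2 * |s - t| := by rw [abs_mul, abs_two, abs_sub_comm]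

/-- The error of approximating the square by `sHat (n + 1)`, as a function on `[0, 1]`. -/
noncomputable def sqError (n : ℕ) (t : ℝ) : ℝ :=
  t^2 - t + ∑ l ∈ Finset.range n, (1/4:ℝ)^(l+1) * hatg^[l+1] t

theorem sq_sub_sHat_succ (n : ℕ) (x : ℝ) : x^2 - sHat (n+1) x = sqError n |x| := by
  have h : ∑ l ∈ Finset.Icc 1 n, (2:ℝ)^(-(2*(l:ℤ))) * hatg^[l] |x|
      = ∑ l ∈ Finset.range n, (1/4:ℝ)^(l+1) * hatg^[l+1] |x| := by
    rw [← Finset.Ico_succ_right_eq_Icc, Finset.sum_Ico_eq_sum_range]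
    refine Finset.sum_congr (by simp) fun l _ => ?_
    rw [add_comm 1 l, zpow_neg, zpow_mul, zpow_natCast, ← inv_pow]
    norm_num
  rw [sHat, sqError, Nat.add_sub_cancel, h, sq_abs]
  ring

theorem sqError_succ (n : ℕ) {t : ℝ} (ht : t ∈ Set.Icc (0:ℝ) 1) :
    sqError (n+1) t = sqError n (hatg t) / 4 := by
  have h : t^2 - t + hatg t / 4 = (hatg t ^ 2 - hatg t) / 4 := by
    rw [hatg_eq_one_sub_abs ht]
    linear_combination (-1/4) * sq_abs (2*t - 1)
  have hsum : ∑ l ∈ Finset.range n, (1/4:ℝ)^(l+1+1) * hatg^[l+1+1] t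
      = (∑ l ∈ Finset.range n, (1/4:ℝ)^(l+1) * hatg^[l+1] (hatg t)) / 4 := by
    rw [Finset.sum_div]
    refine Finset.sum_congr rfl fun l _ => ?_
    rw [Function.iterate_succ_apply]
    ring
  rw [sqError, sqError, Finset.sum_range_succ', hsum, zero_add, Function.iterate_one]
  linear_combination h

theorem abs_sqError_le (n : ℕ) {t : ℝ} (ht : t ∈ Set.Icc (0:ℝ) 1) :
    |sqError n t| ≤ (1/4)^(n+1) := by
  induction n generalizing t with
  | zero =>
    simp only [sqError, Finset.range_zero, Finset.sum_empty]
    rw [abs_le]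
    constructor <;> nlinarith [sq_nonneg (t - 1/2), ht.1, ht.2]
  | succ n ih =>
    rw [sqError_succ n ht, abs_div, abs_of_pos (four_pos : (0:ℝ) < 4), pow_succ]
    linarith [ih (hatg_mem_Icc ht)]

theorem exists_abs_sqError_eq (n : ℕ) :
    ∃ t ∈ Set.Icc (0:ℝ) 1, |sqError n t| = (1/4)^(n+1) := by
  induction n with
  | zero =>
    refine ⟨1/2, by norm_num, ?_⟩
    simp only [sqError, Finset.range_zero, Finset.sum_empty]
    norm_num [abs_of_neg]
  | succ n ih =>
    obtain ⟨t, ht, h⟩ := ih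
    have ht' : t/2 ∈ Set.Icc (0:ℝ) 1 := ⟨by linarith [ht.1], by linarith [ht.2]⟩
    have hg : hatg (t/2) = t := by
      rw [hatg, if_pos ⟨ht'.1, by linarith [ht.2]⟩]
      ring
    refine ⟨t/2, ht', ?_⟩
    rw [sqError_succ n ht', hg, abs_div, h, abs_of_pos (four_pos : (0:ℝ) < 4), pow_succ _ (n+1)]
    ring

theorem abs_sqError_sub_sqError_le (n : ℕ) {s t : ℝ} (hs : s ∈ Set.Icc (0:ℝ) 1)
    (ht : t ∈ Set.Icc (0:ℝ) 1) : |sqError n s - sqError n t| ≤ (1/2)^n * |s - t| := by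
  induction n generalizing s t with
  | zero =>
    simp only [sqError, Finset.range_zero, Finset.sum_empty, add_zero, pow_zero]
    rw [show s^2 - s - (t^2 - t) = (s + t - 1) * (s - t) by ring, abs_mul]
    gcongr
    exact abs_le.mpr ⟨by linarith [hs.1, ht.1], by linarith [hs.2, ht.2]⟩
  | succ n ih =>
    rw [sqError_succ n hs, sqError_succ n ht, ← sub_div, abs_div,
      abs_of_pos (four_pos : (0:ℝ) < 4), div_le_iff₀ four_pos]
    calc |sqError n (hatg s) - sqError n (hatg t)|
        ≤ (1/2)^n * |hatg s - hatg t| := ih (hatg_mem_Icc hs) (hatg_mem_Icc ht)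
      _ ≤ (1/2)^n * (2 * |s - t|) := by gcongr; exact abs_hatg_sub_hatg_le hs ht
      _ = (1/2)^(n+1) * |s - t| * 4 := by ring

theorem stmt4 (L : ℕ) (hL : 1 ≤ L) :
    ((∀ x ∈ Set.Icc (-1:ℝ) 1, |x^2 - sHat L x| ≤ (2:ℝ)^(-(2*(L:ℤ)))) ∧
      (∃ x ∈ Set.Icc (-1:ℝ) 1, |x^2 - sHat L x| = (2:ℝ)^(-(2*(L:ℤ))))) ∧
    (∀ x ∈ Set.Icc (-1:ℝ) 1, ∀ y ∈ Set.Icc (-1:ℝ) 1,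
      |(x^2 - sHat L x) - (y^2 - sHat L y)| ≤ (2:ℝ)^(-((L:ℤ)-1)) * |x - y|) := by
  obtain ⟨n, rfl⟩ := Nat.exists_eq_add_of_le' hL
  have habs {x : ℝ} (hx : x ∈ Set.Icc (-1:ℝ) 1) : |x| ∈ Set.Icc (0:ℝ) 1 :=
    ⟨abs_nonneg x, abs_le.mpr hx⟩
  have hfour : (2:ℝ)^(-(2*((n+1:ℕ):ℤ))) = (1/4)^(n+1) := by
    rw [zpow_neg, zpow_mul, zpow_natCast, ← inv_pow]
    norm_num
  have htwo : (2:ℝ)^(-(((n+1:ℕ):ℤ)-1)) = (1/2)^n := by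
    rw [Nat.cast_add_one, add_sub_cancel_right, zpow_neg, zpow_natCast, ← inv_pow, one_div]
  simp only [hfour, htwo, sq_sub_sHat_succ]
  refine ⟨⟨fun x hx => abs_sqError_le n (habs hx), ?_⟩, fun x hx y hy => ?_⟩
  · obtain ⟨t, ht, h⟩ := exists_abs_sqError_eq n
    exact ⟨t, ⟨by linarith [ht.1], ht.2⟩, by rwa [abs_of_nonneg ht.1]⟩
  · calc |(sqError n |x|) - (sqError n |y|)| ≤ (1/2)^n * |(|x| - |y|)| :=
          abs_sqError_sub_sqError_le n (habs hx) (habs hy)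
      _ ≤ (1/2)^n * |x - y| := 
          mul_le_mul_of_nonneg_left (abs_abs_sub_abs_le x y) (by positivity)
end

section
/- For every integer L ≥ 1, the function ŝ_L is the piecewise linear interpolant of x² on [−1,1] with mesh size h = 2^{1−L}: ŝ_L(−x) = ŝ_L(x) for all x ∈ ℝ, and for every integer i with 0 ≤ i ≤ 2^{L−1} − 1 and every x ∈ [i·h, (i+1)·h] one has ŝ_L(x) = (2i+1)·h·x − i(i+1)·h². -/
theorem hatg_of_le_half {x : ℝ} (h0 : 0 ≤ x) (h1 : x ≤ 1 / 2) : hatg x = 2 * x := by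
  simp only [hatg, if_pos (And.intro h0 h1)]

theorem hatg_of_half_le {x : ℝ} (h0 : 1 / 2 ≤ x) (h1 : x ≤ 1) : hatg x = 2 * (1 - x) := by
  rcases h0.eq_or_lt with rfl | h0
  · norm_num [hatg]
  · rw [hatg, if_neg (fun h => absurd h.2 h0.not_ge), if_pos ⟨h0, h1⟩]

/-- The partial sums `Σ_{ℓ=1}^{n} 4^{-ℓ} g_ℓ` of the sawtooth series. -/
noncomputable def sawtoothSum (n : ℕ) (x : ℝ) : ℝ :=
  ∑ k ∈ Finset.range n, (1 / 4 : ℝ) ^ (k + 1) * hatg^[k + 1] x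

theorem sawtoothSum_succ (n : ℕ) (x : ℝ) :
    sawtoothSum (n + 1) x = (hatg x + sawtoothSum n (hatg x)) / 4 := by
  have hterm : ∀ k, (1 / 4 : ℝ) ^ (k + 1 + 1) * hatg^[k + 1 + 1] x
      = 1 / 4 * ((1 / 4 : ℝ) ^ (k + 1) * hatg^[k + 1] (hatg x)) := by
    intro k
    rw [Function.iterate_succ_apply hatg (k + 1) x, pow_succ (1 / 4 : ℝ) (k + 1)]
    ring
  simp only [sawtoothSum]
  rw [Finset.sum_range_succ', Finset.sum_congr rfl (fun k _ => hterm k), ← Finset.mul_sum]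
  simp only [zero_add, pow_one, Function.iterate_one]
  ring

theorem sHat_eq_sub_sawtoothSum (n : ℕ) (x : ℝ) :
    sHat (n + 1) x = |x| - sawtoothSum n |x| := by
  rw [sHat, sawtoothSum, Nat.add_sub_cancel, Finset.range_eq_Ico,
    Finset.sum_Ico_add' (fun k => (1 / 4 : ℝ) ^ k * hatg^[k] |x|) 0 n 1]
  congr 1
  refine Finset.sum_congr (by ext; simp) fun k _ => ?_
  rw [zpow_neg, zpow_mul, zpow_natCast, one_div, inv_pow]
  norm_num

theorem sub_sawtoothSum_eq_interpolant (n : ℕ) : ∀ i : ℕ, i < 2 ^ n →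
    ∀ x ∈ Set.Icc ((i : ℝ) * (1 / 2) ^ n) (((i : ℝ) + 1) * (1 / 2) ^ n),
      x - sawtoothSum n x = (2 * (i : ℝ) + 1) * (1 / 2) ^ n * x
        - (i : ℝ) * ((i : ℝ) + 1) * ((1 / 2) ^ n) ^ 2 := by
  induction n with
  | zero =>
    intro i hi x _
    obtain rfl : i = 0 := by simpa using hi
    simp [sawtoothSum]
  | succ n ih =>
    intro i hi x hx
    obtain ⟨hx0, hx1⟩ := hx
    have hpow : (2 : ℝ) ^ n * (1 / 2) ^ n = 1 := by rw [← mul_pow]; norm_num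
    have hpos : (0 : ℝ) < (1 / 2) ^ n := by positivity
    rw [sawtoothSum_succ]
    rw [pow_succ (1 / 2 : ℝ) n] at hx0 hx1 ⊢
    generalize (1 / 2 : ℝ) ^ n = t at *
    rcases lt_or_ge i (2 ^ n) with hin | hin
    · have hle : (i : ℝ) + 1 ≤ 2 ^ n := by exact_mod_cast hin
      have hxt : 0 ≤ x := le_trans (by positivity) hx0
      have hxh : x ≤ 1 / 2 := by nlinarith
      have key := ih i hin (2 * x) ⟨by linarith, by linarith⟩
      rw [hatg_of_le_half hxt hxh]
      linear_combination key / 4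
    · obtain ⟨j, hj⟩ : ∃ j, i + j + 1 = 2 ^ (n + 1) :=
        ⟨2 ^ (n + 1) - 1 - i, by omega⟩
      have hjn : j < 2 ^ n := by rw [pow_succ] at hj; omega
      have hjr : (i : ℝ) = 2 * 2 ^ n - 1 - j := by
        have : (i : ℝ) + j + 1 = 2 ^ (n + 1) := by exact_mod_cast hj
        rw [pow_succ] at this
        linarith
      have hle : (j : ℝ) + 1 ≤ 2 ^ n := by exact_mod_cast hjn
      have hit : (i : ℝ) * t = 2 - t - j * t := by
        rw [hjr]; linear_combination 2 * hpow
      have hj0 : 0 ≤ (j : ℝ) * t := by positivity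
      have hxh : 1 / 2 ≤ x := by nlinarith
      have hx1' : x ≤ 1 := by linarith
      have key := ih j hjn (2 * (1 - x)) ⟨by linarith, by linarith⟩
      rw [hatg_of_half_le hxh hx1']
      linear_combination key / 4 + (-x + (i * t + 2 - t - j * t + t) / 4) * hit

theorem stmt5 (L : ℕ) (hL : 1 ≤ L) (h : ℝ) (hh : h = (2:ℝ)^((1:ℤ) - (L:ℤ))) :
    (∀ x : ℝ, sHat L (-x) = sHat L x) ∧
    (∀ i : ℕ, i < 2^(L-1) → ∀ x ∈ Set.Icc ((i:ℝ) * h) (((i:ℝ) + 1) * h),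
      sHat L x = (2*(i:ℝ) + 1) * h * x - (i:ℝ) * ((i:ℝ) + 1) * h^2) := by
  refine ⟨fun x => by simp only [sHat, abs_neg], ?_⟩
  obtain ⟨n, rfl⟩ : ∃ n, L = n + 1 := ⟨L - 1, by omega⟩
  have hn : h = (1 / 2) ^ n := by
    rw [hh, show (1 : ℤ) - ((n + 1 : ℕ) : ℤ) = -(n : ℤ) by push_cast; ring, zpow_neg,
      zpow_natCast, one_div, inv_pow]
  subst hn
  intro i hi x hx
  have hx0 : 0 ≤ x := le_trans (by positivity) hx.1
  rw [sHat_eq_sub_sawtoothSum, abs_of_nonneg hx0]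
  exact sub_sawtoothSum_eq_interpolant n i hi x hx
end

section
/- For every integer L ≥ 1 and every (x, y) ∈ [−1,1]², |x·y − m_L(x, y)| ≤ 6·2^{−2L}. -/
/-- `m_L(x,y) = 2(ŝ_L((x+y)/2) − ŝ_L(x/2) − ŝ_L(y/2))`. -/
noncomputable def mL (L : ℕ) (x y : ℝ) : ℝ :=
  2 * (sHat L ((x + y)/2) - sHat L (x/2) - sHat L (y/2))

theorem hatg_mem_Icc_s8 {x : ℝ} (hx : x ∈ Set.Icc (0:ℝ) 1) : hatg x ∈ Set.Icc (0:ℝ) 1 := by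
  obtain ⟨h0, h1⟩ := hx
  unfold hatg
  split_ifs with h h'
  · constructor <;> linarith
  · constructor <;> linarith
  · simp

theorem sub_half_hatg_sub_sq {x : ℝ} (hx : x ∈ Set.Icc (0:ℝ) 1) :
    x - hatg x / 2 - x ^ 2 = -(hatg x) ^ 2 / 4 := by
  obtain ⟨h0, h1⟩ := hx
  unfold hatg
  split_ifs with h h'
  · ring
  · ring
  · rcases le_or_gt x (1/2) with h2 | h2
    · exact absurd ⟨h0, h2⟩ h
    · exact absurd ⟨h2, h1⟩ h'

theorem two_zpow_neg_two_mul (i : ℕ) : (2:ℝ) ^ (-(2 * (i:ℤ))) = (1 / 4 : ℝ) ^ i := by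
  rw [zpow_neg, zpow_mul, zpow_natCast, one_div, inv_pow]
  norm_num

theorem sHat_succ (n : ℕ) (x : ℝ) :
    sHat (n + 1) x = |x| - ∑ i ∈ Finset.range n, (1 / 4 : ℝ) ^ (i + 1) * hatg^[i + 1] |x| := by
  unfold sHat
  rw [Nat.add_sub_cancel, Finset.range_eq_Ico,
    Finset.sum_Ico_add' (fun i => (1 / 4 : ℝ) ^ i * hatg^[i] |x|) 0 n 1]
  simp only [two_zpow_neg_two_mul]
  rfl

theorem sHat_succ_succ (n : ℕ) {x : ℝ} (hx : x ∈ Set.Icc (0:ℝ) 1) :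
    sHat (n + 2) x = x - hatg x / 2 + sHat (n + 1) (hatg x) / 4 := by
  rw [sHat_succ (n + 1), sHat_succ n, abs_of_nonneg hx.1, abs_of_nonneg (hatg_mem_Icc_s8 hx).1,
    Finset.sum_range_succ']
  have h (i : ℕ) : (1 / 4 : ℝ) ^ (i + 1 + 1) * hatg^[i + 1 + 1] x
      = 1 / 4 * ((1 / 4 : ℝ) ^ (i + 1) * hatg^[i + 1] (hatg x)) := by
    rw [Function.iterate_succ_apply, pow_succ]
    ring
  simp only [h, ← Finset.mul_sum]
  simp only [zero_add, pow_one, Function.iterate_one]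
  ring

theorem sHat_sub_sq_mem_Icc_of_nonneg (n : ℕ) {x : ℝ} (hx : x ∈ Set.Icc (0:ℝ) 1) :
    sHat (n + 1) x - x ^ 2 ∈ Set.Icc (0:ℝ) ((1 / 4) ^ (n + 1)) := by
  induction n generalizing x with
  | zero =>
    rw [sHat_succ, abs_of_nonneg hx.1]
    simp only [Finset.range_zero, Finset.sum_empty, sub_zero, zero_add, pow_one]
    constructor
    · nlinarith [hx.1, hx.2]
    · nlinarith [sq_nonneg (x - 1 / 2)]
  | succ n ih =>
    obtain ⟨h0, h1⟩ := ih (hatg_mem_Icc_s8 hx)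
    have h := sub_half_hatg_sub_sq hx
    rw [sHat_succ_succ n hx, pow_succ]
    constructor <;> linarith

theorem sHat_abs (L : ℕ) (x : ℝ) : sHat L |x| = sHat L x := by
  simp only [sHat, abs_abs]

theorem sHat_sub_sq_mem_Icc (n : ℕ) {x : ℝ} (hx : |x| ≤ 1) :
    sHat (n + 1) x - x ^ 2 ∈ Set.Icc (0:ℝ) ((1 / 4) ^ (n + 1)) := by
  rw [← sHat_abs, ← sq_abs]
  exact sHat_sub_sq_mem_Icc_of_nonneg n ⟨abs_nonneg x, hx⟩

theorem stmt8 (L : ℕ) (hL : 1 ≤ L) (x y : ℝ)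
    (hx : x ∈ Set.Icc (-1:ℝ) 1) (hy : y ∈ Set.Icc (-1:ℝ) 1) :
    |x * y - mL L x y| ≤ 6 * (2:ℝ)^(-(2*(L:ℤ))) := by
  obtain ⟨n, rfl⟩ := Nat.exists_eq_add_of_le' hL
  obtain ⟨hx0, hx1⟩ := hx
  obtain ⟨hy0, hy1⟩ := hy
  obtain ⟨a0, a1⟩ := sHat_sub_sq_mem_Icc n (x := (x + y) / 2)
    (abs_le.mpr ⟨by linarith, by linarith⟩)
  obtain ⟨b0, b1⟩ := sHat_sub_sq_mem_Icc n (x := x / 2) (abs_le.mpr ⟨by linarith, by linarith⟩)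
  obtain ⟨c0, c1⟩ := sHat_sub_sq_mem_Icc n (x := y / 2) (abs_le.mpr ⟨by linarith, by linarith⟩)
  rw [two_zpow_neg_two_mul, mL, abs_le]
  constructor <;> nlinarith
end
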